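/- For every vector u ∈ ℝ^N, the function ξ ↦ uᵀ * Z(ξ)⁻¹ * diagonal(ξ) * u is concave on the convex set Ξ. -/

import Mathlib

open Matrix

section VariationalBound

variable {ι : Type*} [Fintype ι] {A : Matrix ι ι ℝ} {s : ℝ} {ξ : ι → ℝ}

/-- For positive semidefinite `A`, nonnegative `ξ` and `s > 0`, a solution `w₀` of
`(diagonal ξ * A + s) w₀ = diagonal ξ u` minimises
`w ↦ wᵀ A w + s⁻¹ (u - A w)ᵀ diagonal ξ (u - A w)`. -/
theorem Matrix.PosSemidef.variational_bound (hA : A.PosSemidef) (hs : 0 < s)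
    (hξ : ∀ i, 0 ≤ ξ i) {u w₀ : ι → ℝ} (h : ∀ i, ξ i * (u i - (A *ᵥ w₀) i) = s * w₀ i)
    (w : ι → ℝ) :
    u ⬝ᵥ w₀ ≤ w ⬝ᵥ A *ᵥ w + s⁻¹ * ∑ i, ξ i * (u i - (A *ᵥ w) i) ^ 2 := by
  have hsymm : ∀ x y : ι → ℝ, x ⬝ᵥ A *ᵥ y = y ⬝ᵥ A *ᵥ x := fun x y => by
    have ht : Aᵀ = A := by simpa using hA.isHermitian.eq
    rw [dotProduct_mulVec, ← mulVec_transpose, ht, dotProduct_comm]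
  have hdiff : 0 ≤ (w - w₀) ⬝ᵥ A *ᵥ (w - w₀) := by
    simpa using hA.dotProduct_mulVec_nonneg (w - w₀)
  have hquad : ∑ i, (2 * s * (w₀ i * (u i - (A *ᵥ w) i)) - s * (w₀ i * (u i - (A *ᵥ w₀) i)))
      ≤ ∑ i, ξ i * (u i - (A *ᵥ w) i) ^ 2 := by
    refine Finset.sum_le_sum fun i _ => ?_
    linear_combination mul_nonneg (hξ i) (sq_nonneg ((A *ᵥ w₀) i - (A *ᵥ w) i)) +
      (2 * (A *ᵥ w) i - u i - (A *ᵥ w₀) i) * h i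
  have hlin : ∑ i, (2 * s * (w₀ i * (u i - (A *ᵥ w) i)) - s * (w₀ i * (u i - (A *ᵥ w₀) i)))
      = s * (u ⬝ᵥ w₀ - 2 * (w₀ ⬝ᵥ A *ᵥ w) + w₀ ⬝ᵥ A *ᵥ w₀) := by
    simp only [dotProduct, Finset.mul_sum, ← Finset.sum_add_distrib, ← Finset.sum_sub_distrib]
    exact Finset.sum_congr rfl fun i _ => by ring
  have hbound : u ⬝ᵥ w₀ - 2 * (w₀ ⬝ᵥ A *ᵥ w) + w₀ ⬝ᵥ A *ᵥ w₀
      ≤ s⁻¹ * ∑ i, ξ i * (u i - (A *ᵥ w) i) ^ 2 := by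
    rw [le_inv_mul_iff₀ hs, ← hlin]
    exact hquad
  simp only [mulVec_sub, dotProduct_sub, sub_dotProduct, hsymm w w₀] at hdiff
  linarith

theorem Matrix.variational_value (hs : s ≠ 0) {u w₀ : ι → ℝ}
    (h : ∀ i, ξ i * (u i - (A *ᵥ w₀) i) = s * w₀ i) :
    w₀ ⬝ᵥ A *ᵥ w₀ + s⁻¹ * ∑ i, ξ i * (u i - (A *ᵥ w₀) i) ^ 2 = u ⬝ᵥ w₀ := by
  simp only [dotProduct, Finset.mul_sum, ← Finset.sum_add_distrib]
  refine Finset.sum_congr rfl fun i _ => ?_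
  rw [sq, ← mul_assoc (ξ i), h i]
  field_simp
  ring

variable [DecidableEq ι]

theorem Matrix.PosDef.isUnit_det_diagonal_mul_add_smul_one (hA : A.PosDef) (hs : 0 < s)
    (hξ : ∀ i, 0 ≤ ξ i) : IsUnit (diagonal ξ * A + s • (1 : Matrix ι ι ℝ)).det := by
  rw [isUnit_iff_ne_zero]
  intro hdet
  obtain ⟨v, hv, hZ⟩ := exists_mulVec_eq_zero_iff.mpr hdet
  have h : ∀ i, ξ i * ((A *ᵥ v) i) = -(s * v i) := fun i => by
    have := congrFun hZ i
    simp [add_mulVec, ← mulVec_mulVec, mulVec_diagonal, smul_mulVec] at this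
    linarith
  have hpos : 0 < v ⬝ᵥ A *ᵥ v := by simpa using hA.dotProduct_mulVec_pos hv
  have hnonneg : 0 ≤ ∑ i, ξ i * ((A *ᵥ v) i) ^ 2 :=
    Finset.sum_nonneg fun i _ => mul_nonneg (hξ i) (sq_nonneg _)
  have heq : ∑ i, ξ i * ((A *ᵥ v) i) ^ 2 = -(s * (v ⬝ᵥ A *ᵥ v)) := by
    simp only [dotProduct, Finset.mul_sum, ← Finset.sum_neg_distrib]
    exact Finset.sum_congr rfl fun i _ => by linear_combination (A *ᵥ v) i * h i
  linarith [mul_pos hs hpos]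

theorem Matrix.PosDef.diagonal_mul_add_smul_one_inv_mulVec_spec (hA : A.PosDef) (hs : 0 < s)
    (hξ : ∀ i, 0 ≤ ξ i) (u : ι → ℝ) (i : ι) :
    ξ i * (u i - (A *ᵥ (((diagonal ξ * A + s • (1 : Matrix ι ι ℝ))⁻¹ * diagonal ξ) *ᵥ u)) i) =
      s * (((diagonal ξ * A + s • (1 : Matrix ι ι ℝ))⁻¹ * diagonal ξ) *ᵥ u) i := by
  set w := ((diagonal ξ * A + s • (1 : Matrix ι ι ℝ))⁻¹ * diagonal ξ) *ᵥ u with hw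
  have hZ : (diagonal ξ * A + s • (1 : Matrix ι ι ℝ)) *ᵥ w = diagonal ξ *ᵥ u := by
    rw [hw, mulVec_mulVec, ← Matrix.mul_assoc,
      mul_nonsing_inv _ (hA.isUnit_det_diagonal_mul_add_smul_one hs hξ), Matrix.one_mul]
  have := congrFun hZ i
  simp only [add_mulVec, ← mulVec_mulVec, mulVec_diagonal, smul_mulVec, one_mulVec,
    Pi.add_apply, Pi.smul_apply, smul_eq_mul] at this
  linarith

/-- The parallel-sum quadratic form `ξ ↦ uᵀ (diagonal ξ * A + s)⁻¹ diagonal ξ u` is concave on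
every convex set of nonnegative vectors. -/
theorem Matrix.PosDef.concaveOn_diagonal_mul_add_smul_one_inv (hA : A.PosDef) (hs : 0 < s)
    {S : Set (ι → ℝ)} (hS : Convex ℝ S) (hS0 : ∀ ξ ∈ S, ∀ i, 0 ≤ ξ i) (u : ι → ℝ) :
    ConcaveOn ℝ S (fun ξ =>
      u ⬝ᵥ (((diagonal ξ * A + s • (1 : Matrix ι ι ℝ))⁻¹ * diagonal ξ) *ᵥ u)) := by
  refine ⟨hS, fun x hx y hy a b ha hb hab => ?_⟩
  have hz := hS0 _ (hS hx hy ha hb hab)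
  have hspec := fun ξ hξ =>
    hA.diagonal_mul_add_smul_one_inv_mulVec_spec (ξ := ξ) hs hξ u
  have bound := fun ξ hξ w => hA.posSemidef.variational_bound hs hξ (hspec ξ hξ) w
  simp only [smul_eq_mul]
  rw [← variational_value hs.ne' (hspec _ hz)]
  set w := ((diagonal (a • x + b • y) * A + s • (1 : Matrix ι ι ℝ))⁻¹ *
    diagonal (a • x + b • y)) *ᵥ u
  have hsum : ∑ i, (a • x + b • y) i * (u i - (A *ᵥ w) i) ^ 2 =
      a * ∑ i, x i * (u i - (A *ᵥ w) i) ^ 2 + b * ∑ i, y i * (u i - (A *ᵥ w) i) ^ 2 := by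
    simp only [Finset.mul_sum, ← Finset.sum_add_distrib]
    exact Finset.sum_congr rfl fun i _ => by simp; ring
  rw [hsum]
  linear_combination a * bound x (hS0 x hx) w + b * bound y (hS0 y hy) w +
    (w ⬝ᵥ A *ᵥ w) * hab

end VariationalBound

/-- **Lemma A1**: for every `u ∈ ℝ^N`, the function
`ξ ↦ uᵀ Z(ξ)⁻¹ diagonal(ξ) u` is concave on the set `Ξ` of design measures,
where `Z ξ = diagonal ξ * (C - κ•I) + (κ/n)•I`. -/
theorem stmt_2 (N n p : ℕ) (hN : 0 < N) (hn : 0 < n) (hp : 0 < p)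
    (C : Matrix (Fin N) (Fin N) ℝ) (hC : C.PosDef)
    (κ : ℝ) (hκ : 0 < κ)
    (hCκ : (C - κ • (1 : Matrix (Fin N) (Fin N) ℝ)).PosDef)
    (u : Fin N → ℝ) :
    ConcaveOn ℝ
      {ξ : Fin N → ℝ | ∑ i, ξ i = 1 ∧ ∀ i, 0 ≤ ξ i ∧ ξ i ≤ 1 / (n : ℝ)}
      (fun ξ =>
        u ⬝ᵥ (((Matrix.diagonal ξ * (C - κ • 1) + (κ / (n : ℝ)) • 1)⁻¹ *
          Matrix.diagonal ξ) *ᵥ u)) := by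
  have hs : 0 < κ / (n : ℝ) := div_pos hκ (Nat.cast_pos.mpr hn)
  refine hCκ.concaveOn_diagonal_mul_add_smul_one_inv hs ?_ (fun ξ hξ i => (hξ.2 i).1) u
  rintro x ⟨hx1, hx⟩ y ⟨hy1, hy⟩ a b ha hb hab
  refine ⟨?_, fun i => ⟨?_, ?_⟩⟩
  · simp [Finset.sum_add_distrib, ← Finset.mul_sum, hx1, hy1, hab]
  · exact add_nonneg (mul_nonneg ha (hx i).1) (mul_nonneg hb (hy i).1)
  · exact convex_Iic (1 / (n : ℝ)) (hx i).2 (hy i).2 ha hb hab
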